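/- arXiv:1312.6047 — 3 statements merged into one kernel-verified Lean document; each statement's English description precedes it below -/
import Mathlib

section
/- Let V and W be real Hilbert spaces, let m : V × V → ℝ be a symmetric bounded bilinear form with |m(v, v')| ≤ Λ ‖v‖_V ‖v'‖_V, let B : V → W be a bounded linear operator and b(v, w) := ⟨B v, w⟩_W, let V_h ⊆ V and W_h ⊆ W be closed subspaces with B(V_h) ⊆ W_h, and let P_h denote the orthogonal projection of W onto W_h. Let (q, u) ∈ V × W satisfy m(q, v) + b(v, u) = G(v) for all v ∈ V and b(q, w) = F(w) for all w ∈ W, and let (q_h, u_h) ∈ V_h × W_h satisfy the same equations tested against V_h and W_h, for the same G ∈ V' and F ∈ W'. Let (z, φ) ∈ V × W solve the dual problem m(v, z) + b(v, φ) = 0 for all v ∈ V and b(z, w) = ⟨P_h u − u_h, w⟩_W for all w ∈ W, and let (z_h, φ_h) ∈ V_h × W_h solve the same dual problem tested against V_h and W_h. Then ‖P_h u − u_h‖_W² ≤ Λ ‖q − q_h‖_V ‖z − z_h‖_V + ‖B(q − q_h)‖_W ‖φ − P_h φ‖_W. -/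
open scoped RealInnerProductSpace

/-- Abstract duality bound for the superconvergence of the projected pressure
in mixed finite element methods:
`‖P_h u − u_h‖² ≤ Λ ‖q − q_h‖ ‖z − z_h‖ + ‖B(q − q_h)‖ ‖φ − P_h φ‖`. -/
theorem projected_pressure_duality_bound
    {V W : Type*}
    [NormedAddCommGroup V] [InnerProductSpace ℝ V] [CompleteSpace V]
    [NormedAddCommGroup W] [InnerProductSpace ℝ W] [CompleteSpace W]
    (m : V →ₗ[ℝ] V →ₗ[ℝ] ℝ) (Λ : ℝ)
    (hm_symm : ∀ v v' : V, m v v' = m v' v)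
    (hm_bdd : ∀ v v' : V, |m v v'| ≤ Λ * ‖v‖ * ‖v'‖)
    (B : V →L[ℝ] W)
    (Vh : Submodule ℝ V) (Wh : Submodule ℝ W)
    (hVh_closed : IsClosed (Vh : Set V)) (hWh_closed : IsClosed (Wh : Set W))
    (hBVh : ∀ vh ∈ Vh, B vh ∈ Wh)
    -- P_h is the orthogonal projection of W onto W_h
    (Ph : W →L[ℝ] W)
    (hPh_mem : ∀ w : W, Ph w ∈ Wh)
    (hPh_orth : ∀ w : W, ∀ wh ∈ Wh, ⟪w - Ph w, wh⟫ = 0)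
    (G : V →L[ℝ] ℝ) (F : W →L[ℝ] ℝ)
    -- continuous primal problem
    (q : V) (u : W)
    (hEq1 : ∀ v : V, m q v + ⟪B v, u⟫ = G v)
    (hEq2 : ∀ w : W, ⟪B q, w⟫ = F w)
    -- discrete primal problem
    (qh : V) (uh : W) (hqh : qh ∈ Vh) (huh : uh ∈ Wh)
    (hEq1h : ∀ vh ∈ Vh, m qh vh + ⟪B vh, uh⟫ = G vh)
    (hEq2h : ∀ wh ∈ Wh, ⟪B qh, wh⟫ = F wh)
    -- continuous dual problem
    (z : V) (φ : W)
    (hDual1 : ∀ v : V, m v z + ⟪B v, φ⟫ = 0)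
    (hDual2 : ∀ w : W, ⟪B z, w⟫ = ⟪Ph u - uh, w⟫)
    -- discrete dual problem
    (zh : V) (φh : W) (hzh : zh ∈ Vh) (hφh : φh ∈ Wh)
    (hDual1h : ∀ vh ∈ Vh, m vh zh + ⟪B vh, φh⟫ = 0)
    (hDual2h : ∀ wh ∈ Wh, ⟪B zh, wh⟫ = ⟪Ph u - uh, wh⟫) :
    ‖Ph u - uh‖ ^ 2
      ≤ Λ * ‖q - qh‖ * ‖z - zh‖ + ‖B (q - qh)‖ * ‖φ - Ph φ‖ := by
  have h1 := hDual2h (Ph u - uh) (Wh.sub_mem (hPh_mem u) huh)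
  have h2 := hPh_orth u (B zh) (hBVh zh hzh)
  rw [real_inner_comm] at h2
  have h3 := hEq1 zh
  have h4 := hEq1h zh hzh
  have h5 := hDual1 (q - qh)
  have h6 : ⟪B (q - qh), Ph φ⟫ = 0 := by
    rw [map_sub, inner_sub_left, hEq2, hEq2h _ (hPh_mem φ), sub_self]
  have h7 := (le_abs_self _).trans (hm_bdd (q - qh) (z - zh))
  have h8 := real_inner_le_norm (B (q - qh)) (φ - Ph φ)
  have h9 : m (q - qh) (z - zh) = m (q - qh) z - m q zh + m qh zh := by
    simp only [map_sub, LinearMap.sub_apply]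
    ring
  rw [real_inner_self_eq_norm_sq] at h1
  rw [inner_sub_right] at h1 h2 h8
  linarith
end

section
/- Let V and W be real Hilbert spaces, let m : V × V → ℝ be a symmetric bounded bilinear form with |m(v, v')| ≤ Λ ‖v‖_V ‖v'‖_V, let B : V → W be a bounded linear operator and b(v, w) := ⟨B v, w⟩_W, let V_h ⊆ V and W_h ⊆ W be closed subspaces with B(V_h) ⊆ W_h, and let P_h denote the orthogonal projection of W onto W_h. Let ℳ ∈ V' be a bounded linear functional. Let (q, u) ∈ V × W satisfy m(q, v) + b(v, u) = G(v) for all v ∈ V and b(q, w) = F(w) for all w ∈ W, and let (q_h, u_h) ∈ V_h × W_h satisfy the same equations tested against V_h and W_h, for the same G ∈ V' and F ∈ W'. Let (z, φ) ∈ V × W solve the dual problem m(v, z) + b(v, φ) = ℳ(v) for all v ∈ V and b(z, w) = 0 for all w ∈ W, and let (z_h, φ_h) ∈ V_h × W_h solve the same dual problem tested against V_h and W_h. Then |ℳ(q − q_h)| ≤ Λ ‖q − q_h‖_V ‖z − z_h‖_V + ‖B(q − q_h)‖_W ‖φ − P_h φ‖_W. -/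
open scoped RealInnerProductSpace

/-- Abstract duality bound for bounded linear functionals of the Darcy
velocity in mixed finite element methods:
`|ℳ(q − q_h)| ≤ Λ ‖q − q_h‖ ‖z − z_h‖ + ‖B(q − q_h)‖ ‖φ − P_h φ‖`. -/
theorem velocity_functional_duality_bound
    {V W : Type*}
    [NormedAddCommGroup V] [InnerProductSpace ℝ V] [CompleteSpace V]
    [NormedAddCommGroup W] [InnerProductSpace ℝ W] [CompleteSpace W]
    (m : V →ₗ[ℝ] V →ₗ[ℝ] ℝ) (Λ : ℝ)
    (hm_symm : ∀ v v' : V, m v v' = m v' v)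
    (hm_bdd : ∀ v v' : V, |m v v'| ≤ Λ * ‖v‖ * ‖v'‖)
    (B : V →L[ℝ] W)
    (Vh : Submodule ℝ V) (Wh : Submodule ℝ W)
    (hVh_closed : IsClosed (Vh : Set V)) (hWh_closed : IsClosed (Wh : Set W))
    (hBVh : ∀ vh ∈ Vh, B vh ∈ Wh)
    -- P_h is the orthogonal projection of W onto W_h
    (Ph : W →L[ℝ] W)
    (hPh_mem : ∀ w : W, Ph w ∈ Wh)
    (hPh_orth : ∀ w : W, ∀ wh ∈ Wh, ⟪w - Ph w, wh⟫ = 0)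
    -- the bounded linear functional of the velocity
    (ℳ : V →L[ℝ] ℝ)
    (G : V →L[ℝ] ℝ) (F : W →L[ℝ] ℝ)
    -- continuous primal problem
    (q : V) (u : W)
    (hEq1 : ∀ v : V, m q v + ⟪B v, u⟫ = G v)
    (hEq2 : ∀ w : W, ⟪B q, w⟫ = F w)
    -- discrete primal problem
    (qh : V) (uh : W) (hqh : qh ∈ Vh) (huh : uh ∈ Wh)
    (hEq1h : ∀ vh ∈ Vh, m qh vh + ⟪B vh, uh⟫ = G vh)
    (hEq2h : ∀ wh ∈ Wh, ⟪B qh, wh⟫ = F wh)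
    -- continuous dual problem
    (z : V) (φ : W)
    (hDual1 : ∀ v : V, m v z + ⟪B v, φ⟫ = ℳ v)
    (hDual2 : ∀ w : W, ⟪B z, w⟫ = 0)
    -- discrete dual problem
    (zh : V) (φh : W) (hzh : zh ∈ Vh) (hφh : φh ∈ Wh)
    (hDual1h : ∀ vh ∈ Vh, m vh zh + ⟪B vh, φh⟫ = ℳ vh)
    (hDual2h : ∀ wh ∈ Wh, ⟪B zh, wh⟫ = 0) :
    |ℳ (q - qh)|
      ≤ Λ * ‖q - qh‖ * ‖z - zh‖ + ‖B (q - qh)‖ * ‖φ - Ph φ‖ := by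
  have hB0 : B zh = 0 := inner_self_eq_zero.mp (hDual2h (B zh) (hBVh zh hzh))
  have h1 := hEq1 zh
  have h2 := hEq1h zh hzh
  rw [hB0, inner_zero_left, add_zero] at h1 h2
  have h3 : m (q - qh) zh = 0 := by
    rw [map_sub, LinearMap.sub_apply, h1, h2, sub_self]
  have h4 : ⟪B (q - qh), Ph φ⟫ = 0 := by
    rw [map_sub, inner_sub_left, hEq2, hEq2h _ (hPh_mem φ), sub_self]
  have h5 : ℳ (q - qh) = m (q - qh) (z - zh) + ⟪B (q - qh), φ - Ph φ⟫ := by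
    rw [← hDual1 (q - qh), map_sub (m (q - qh)) z zh, inner_sub_right, h3, h4, sub_zero, sub_zero]
  rw [h5]
  exact (abs_add_le _ _).trans (add_le_add (hm_bdd _ _) (abs_real_inner_le_norm _ _))
end

section
/- Let p₀, p₁, p₂ ∈ ℝ² be affinely independent points, let T be the closed triangle with these vertices, and for k ∈ {0, 1, 2} let E_k denote the edge of T opposite p_k. Then there exists a constant C > 0, depending only on T, such that: for every function w : ∂T → ℝ that is square integrable on each edge E_k, the unique affine function χ : ℝ² → ℝ satisfying ∫_{E_k} χ ds = ∫_{E_k} w ds for k = 0, 1, 2 obeys the stability bound ‖χ‖_{L²(T)} ≤ C Σ_{k=0}^{2} ‖w‖_{L²(E_k)}. -/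
open scoped RealInnerProductSpace
open MeasureTheory

/-- The integral of `χ` over the segment with endpoints `p` and `q`:
`∫_E χ ds := ‖q − p‖ ∫₀¹ χ((1−t)p + tq) dt`. -/
noncomputable def edgeIntegral (χ : EuclideanSpace ℝ (Fin 2) → ℝ)
    (p q : EuclideanSpace ℝ (Fin 2)) : ℝ :=
  ‖q - p‖ * ∫ t in (0 : ℝ)..1, χ ((1 - t) • p + t • q)

/-- Cauchy-Schwarz on the unit interval. -/
lemma sq_interval_le (f : ℝ → ℝ) (h1 : IntervalIntegrable f volume 0 1)
    (h2 : IntervalIntegrable (fun t => f t ^ 2) volume 0 1) :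
    (∫ t in (0 : ℝ)..1, f t) ^ 2 ≤ ∫ t in (0 : ℝ)..1, f t ^ 2 := by
  set m := ∫ t in (0 : ℝ)..1, f t with hm
  have h0 : 0 ≤ ∫ t in (0 : ℝ)..1, (f t - m) ^ 2 :=
    intervalIntegral.integral_nonneg (by norm_num) (fun t _ => sq_nonneg _)
  have e : ∀ t, (f t - m) ^ 2 = (f t ^ 2 - (2 * m) * f t) + m ^ 2 := fun t => by ring
  simp only [e] at h0
  rw [intervalIntegral.integral_add (h2.sub (h1.const_mul _)) (by simp),
    intervalIntegral.integral_sub h2 (h1.const_mul _),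
    intervalIntegral.integral_const_mul, ← hm] at h0
  simp at h0
  nlinarith

/-- The average of an affine function over an edge. -/
lemma affine_edge (c : ℝ) (g a b : EuclideanSpace ℝ (Fin 2)) :
    ∫ t in (0 : ℝ)..1, (c + ⟪g, (1 - t) • a + t • b⟫)
      = ((c + ⟪g, a⟫) + (c + ⟪g, b⟫)) / 2 := by
  have e : ∀ t : ℝ, c + ⟪g, (1 - t) • a + t • b⟫
      = (c + ⟪g, a⟫) + t * (⟪g, b⟫ - ⟪g, a⟫) := fun t => by
    rw [inner_add_right, inner_smul_right, inner_smul_right]; ring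
  simp only [e]
  rw [intervalIntegral.integral_add (by simp) (Continuous.intervalIntegrable (by fun_prop) _ _),
    intervalIntegral.integral_mul_const, integral_id]
  simp
  ring

/-- Stability of the affine edge-average recovery on a nondegenerate triangle
`T` with vertices `p 0, p 1, p 2`: there is a constant `C > 0`, depending only
on the triangle, such that for any `w` that is square integrable on each edge,
the unique affine function `χ(x) = c + ⟪g, x⟫` with
`∫_{E_k} χ ds = ∫_{E_k} w ds` for `k = 0, 1, 2` satisfies
`‖χ‖_{L²(T)} ≤ C ∑_k ‖w‖_{L²(E_k)}`, where `E_k` is the edge opposite `p k`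
(with endpoints `p (k+1)` and `p (k+2)`). -/
theorem affine_recovery_L2_stability
    (p : Fin 3 → EuclideanSpace ℝ (Fin 2))
    (hp : AffineIndependent ℝ p) :
    ∃ C : ℝ, 0 < C ∧
      ∀ w : EuclideanSpace ℝ (Fin 2) → ℝ,
        (∀ k : Fin 3, IntervalIntegrable
          (fun t => w ((1 - t) • p (k + 1) + t • p (k + 2))) volume 0 1) →
        (∀ k : Fin 3, IntervalIntegrable
          (fun t => (w ((1 - t) • p (k + 1) + t • p (k + 2))) ^ 2) volume 0 1) →
        ∀ (c : ℝ) (g : EuclideanSpace ℝ (Fin 2)),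
          (∀ k : Fin 3,
            edgeIntegral (fun x => c + ⟪g, x⟫) (p (k + 1)) (p (k + 2))
              = edgeIntegral w (p (k + 1)) (p (k + 2))) →
          Real.sqrt (∫ x in convexHull ℝ (Set.range p), (c + ⟪g, x⟫) ^ 2)
            ≤ C * ∑ k : Fin 3, Real.sqrt (‖p (k + 2) - p (k + 1)‖ *
                ∫ t in (0 : ℝ)..1,
                  (w ((1 - t) • p (k + 1) + t • p (k + 2))) ^ 2) := by
  set L : Fin 3 → ℝ := fun k => Real.sqrt ‖p (k + 2) - p (k + 1)‖ with hL
  have hlen : ∀ k : Fin 3, 0 < ‖p (k + 2) - p (k + 1)‖ := fun k => by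
    rw [norm_pos_iff, sub_ne_zero]
    intro h
    have := hp.injective h
    revert this
    fin_cases k <;> decide
  have hLpos : ∀ k, 0 < L k := fun k => Real.sqrt_pos.2 (hlen k)
  set M : ℝ := ∑ k, (L k)⁻¹ with hM
  have hMle : ∀ k, (L k)⁻¹ ≤ M := fun k =>
    Finset.single_le_sum (f := fun k => (L k)⁻¹) (fun i _ => (inv_pos.2 (hLpos i)).le)
      (Finset.mem_univ k)
  have hM0 : 0 ≤ M := Finset.sum_nonneg (fun i _ => (inv_pos.2 (hLpos i)).le)
  set A : ℝ := volume.real (convexHull ℝ (Set.range p)) with hA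
  have hA0 : 0 ≤ A := measureReal_nonneg
  refine ⟨Real.sqrt A * M + 1, by positivity, ?_⟩
  intro w hw1 hw2 c g heq
  set S : Fin 3 → ℝ := fun k => Real.sqrt (‖p (k + 2) - p (k + 1)‖ *
                ∫ t in (0 : ℝ)..1,
                  (w ((1 - t) • p (k + 1) + t • p (k + 2))) ^ 2) with hS
  have hS0 : ∀ k, 0 ≤ S k := fun k => Real.sqrt_nonneg _
  have hSum0 : 0 ≤ ∑ k, S k := Finset.sum_nonneg (fun k _ => hS0 k)
  have hm : ∀ k : Fin 3,
      |((c + ⟪g, p (k + 1)⟫) + (c + ⟪g, p (k + 2)⟫)) / 2| ≤ M * S k := fun k => by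
    have h := heq k
    unfold edgeIntegral at h
    have h' := mul_left_cancel₀ (hlen k).ne' h
    rw [affine_edge] at h'
    rw [h']
    have h3 : |∫ t in (0 : ℝ)..1, w ((1 - t) • p (k + 1) + t • p (k + 2))|
        ≤ Real.sqrt (∫ t in (0 : ℝ)..1, (w ((1 - t) • p (k + 1) + t • p (k + 2))) ^ 2) :=
      Real.abs_le_sqrt (sq_interval_le _ (hw1 k) (hw2 k))
    refine h3.trans ?_
    have h4 : S k = L k * Real.sqrt (∫ t in (0 : ℝ)..1,
        (w ((1 - t) • p (k + 1) + t • p (k + 2))) ^ 2) := Real.sqrt_mul (hlen k).le _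
    calc _ = (L k)⁻¹ * S k := by
          rw [h4, inv_mul_cancel_left₀ (hLpos k).ne']
      _ ≤ _ := mul_le_mul_of_nonneg_right (hMle k) (hS0 k)
  have hv : ∀ i, |c + ⟪g, p i⟫| ≤ M * ∑ k, S k := by
    have a0 := abs_le.1 (hm 0)
    have a1 := abs_le.1 (hm 1)
    have a2 := abs_le.1 (hm 2)
    have e1 : (1 : Fin 3) + 1 = 2 := rfl
    have e2 : (1 : Fin 3) + 2 = 0 := rfl
    have e3 : (2 : Fin 3) + 1 = 0 := rfl
    have e4 : (2 : Fin 3) + 2 = 1 := rfl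
    rw [e1, e2] at a1
    rw [e3, e4] at a2
    rw [zero_add, zero_add] at a0
    rw [Fin.sum_univ_three]
    intro i
    rw [abs_le]
    fin_cases i <;> simp only [Fin.zero_eta, Fin.mk_one, Fin.reduceFinMk] <;>
      constructor <;> linarith [a0.1, a0.2, a1.1, a1.2, a2.1, a2.2]
  set B := M * ∑ k, S k with hB
  have hB0 : 0 ≤ B := mul_nonneg hM0 hSum0
  have hx : ∀ x ∈ convexHull ℝ (Set.range p), |c + ⟪g, x⟫| ≤ B := by
    intro x hx
    have hconv : Convex ℝ {x : EuclideanSpace ℝ (Fin 2) | |c + ⟪g, x⟫| ≤ B} := by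
      intro x hx y hy a b ha hb hab
      simp only [Set.mem_ofPred_eq, abs_le] at hx hy ⊢
      rw [inner_add_right, inner_smul_right, inner_smul_right]
      obtain rfl : a = 1 - b := by linarith
      constructor <;>
      nlinarith [mul_le_mul_of_nonneg_left hx.1 ha, mul_le_mul_of_nonneg_left hx.2 ha,
        mul_le_mul_of_nonneg_left hy.1 hb, mul_le_mul_of_nonneg_left hy.2 hb]
    exact convexHull_min (by rintro _ ⟨i, rfl⟩; exact hv i) hconv hx
  have hfin : volume (convexHull ℝ (Set.range p)) < ⊤ :=
    ((Set.finite_range p).isCompact_convexHull ℝ).measure_lt_top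
  have hIntBound : (∫ x in convexHull ℝ (Set.range p), (c + ⟪g, x⟫) ^ 2) ≤ B ^ 2 * A := by
    refine (Real.le_norm_self _).trans (norm_setIntegral_le_of_norm_le_const hfin ?_)
    intro x h
    rw [Real.norm_eq_abs, abs_pow]
    exact pow_le_pow_left₀ (abs_nonneg _) (hx x h) 2
  calc _ ≤ Real.sqrt (B ^ 2 * A) := Real.sqrt_le_sqrt hIntBound
    _ = B * Real.sqrt A := by rw [Real.sqrt_mul (sq_nonneg _), Real.sqrt_sq hB0]
    _ ≤ (Real.sqrt A * M + 1) * ∑ k, S k := by rw [hB]; nlinarith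
end
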